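/- arXiv:1212.6607 — 5 statements merged into one kernel-verified Lean document; each statement's English description precedes it below -/
import Mathlib

section
/- Let T=(Q,A,B,→,O,H) be a finite non-blocking alternating transition system and let RP={(1,q₁,a₁,N₁),…,(k,q_k,a_k,N_k)} be a reactive plan of T such that for every plan state i and every q∈Q there exists at most one plan state j∈N_i with q_j=q. Let f_RP be the control strategy generated by RP. Then Out_T(q₁,f_RP) is exactly the set of trajectories generated by RP. -/
/-! Common definitions: alternating transition systems, control strategies and
their outcomes, LTL₋X, reactive plans, Büchi automata, product automata,
the `ReN` function, and the accepting transition system `T_fin`.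
All infinite sequences are modeled as functions `ℕ → X` (0-indexed: index `i`
corresponds to position `i+1` of the paper), finite non-empty sequences as
`List X`. -/

/-- Alternating transition system with states `Q`, control labels `A`,
disturbance labels `B` and observations `O`. -/
structure ATS (Q A B O : Type*) where
  trans : Q → A → B → Q → Prop
  obs : Q → O

namespace ATS

variable {Q A B O : Type*}

/-- `T` is non-blocking. -/
def NonBlocking (T : ATS Q A B O) : Prop :=
  ∀ q a b, ∃ q', T.trans q a b q'

/-- `σ` is an (infinite) trajectory of `T`. -/
def Traj (T : ATS Q A B O) (σ : ℕ → Q) : Prop :=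
  ∀ i, ∃ a b, T.trans (σ i) a b (σ (i + 1))

end ATS

/-- The prefix `σ[1,n]` (first `n` entries) of an infinite sequence. -/
def prefixSeq {X : Type*} (σ : ℕ → X) (n : ℕ) : List X :=
  (List.range n).map σ

/-- `s ∈ Out⁺_T(q,f)` : `s` is a (non-empty) finite outcome of the control
strategy `f` from `q`. -/
def FinOutcome {Q A B O : Type*} (T : ATS Q A B O) (f : List Q → A) (q : Q)
    (s : List Q) : Prop :=
  s ≠ [] ∧ s.head? = some q ∧
    ∀ (i : ℕ) x y, s[i]? = some x → s[i + 1]? = some y →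
      ∃ b, T.trans x (f (s.take (i + 1))) b y

/-- `σ ∈ Out_T(q,f)` : `σ` is an infinite outcome of the control strategy `f`
from `q`. -/
def InfOutcome {Q A B O : Type*} (T : ATS Q A B O) (f : List Q → A) (q : Q)
    (σ : ℕ → Q) : Prop :=
  σ 0 = q ∧ ∀ i, ∃ b, T.trans (σ i) (f (prefixSeq σ (i + 1))) b (σ (i + 1))

/-- LTL₋X formulas over atomic propositions `P`. -/
inductive LTL (P : Type*) where
  | atom : P → LTL P
  | neg : LTL P → LTL P
  | conj : LTL P → LTL P → LTL P
  | until_ : LTL P → LTL P → LTL P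

/-- Satisfaction of an LTL₋X formula at position `i` (0-indexed) of an infinite
word `w` over `2^P`. -/
def LTL.SatAt {P : Type*} (w : ℕ → Set P) : ℕ → LTL P → Prop
  | i, .atom p => p ∈ w i
  | i, .neg φ => ¬ LTL.SatAt w i φ
  | i, .conj φ ψ => LTL.SatAt w i φ ∧ LTL.SatAt w i ψ
  | i, .until_ φ ψ =>
      ∃ j, i ≤ j ∧ LTL.SatAt w j ψ ∧ ∀ k, i ≤ k → k < j → LTL.SatAt w k φ

/-- `w ⊨ φ`. -/
def LTL.Sat {P : Type*} (w : ℕ → Set P) (φ : LTL P) : Prop :=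
  LTL.SatAt w 0 φ

/-- `σ ⊨_∏ φ` for an infinite sequence of states and valuation `Pi`. -/
def SatTraj {Q P : Type*} (Pi : Q → Set P) (σ : ℕ → Q) (φ : LTL P) : Prop :=
  LTL.Sat (fun i => Pi (σ i)) φ

/-- A reactive plan with plan states `1,…,k` modeled as `Fin k`
(plan state 1 is `⟨0, hk⟩`), world-state labels `lab`, actions `act` and
successor sets `N`. -/
structure ReactivePlan (Q A : Type*) where
  k : ℕ
  hk : 0 < k
  lab : Fin k → Q
  act : Fin k → A
  N : Fin k → Set (Fin k)

namespace ReactivePlan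

variable {Q A : Type*}

/-- Plan state 1. -/
def one (RP : ReactivePlan Q A) : Fin RP.k := ⟨0, RP.hk⟩

/-- `σ` is a trajectory generated by `RP`. -/
def Traj (RP : ReactivePlan Q A) (σ : ℕ → Q) : Prop :=
  ∃ σN : ℕ → Fin RP.k, σN 0 = RP.one ∧
    ∀ j, σN (j + 1) ∈ RP.N (σN j) ∧ RP.lab (σN j) = σ j

/-- `s` is a finite path of `RP`. -/
def IsPath (RP : ReactivePlan Q A) (s : List (Fin RP.k)) : Prop :=
  1 < s.length ∧ ∀ (i : ℕ) x y, s[i]? = some x → s[i + 1]? = some y → y ∈ RP.N x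

/-- `RP` satisfies `φ` w.r.t. the valuation `Pi`. -/
def SatPlan {P : Type*} (RP : ReactivePlan Q A) (φ : LTL P) (Pi : Q → Set P) :
    Prop :=
  (∃ σ, RP.Traj σ) ∧ ∀ σ, RP.Traj σ → SatTraj Pi σ φ

/-- `RP` is a reactive plan of the alternating transition system `T`. -/
def OfATS {B O : Type*} (RP : ReactivePlan Q A) (T : ATS Q A B O) : Prop :=
  ∀ i, {x | ∃ j ∈ RP.N i, RP.lab j = x} =
    {q' | ∃ b, T.trans (RP.lab i) (RP.act i) b q'}

/-- `sN` is a plan-state sequence matching the world-state sequence `s`: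
it has the same length, starts in plan state 1, consecutive plan states are
successors, and labels agree with `s`. -/
def PlanMatch (RP : ReactivePlan Q A) (s : List Q) (sN : List (Fin RP.k)) :
    Prop :=
  sN.length = s.length ∧ sN.head? = some RP.one ∧
    (∀ (j : ℕ) x y, sN[j]? = some x → sN[j + 1]? = some y → y ∈ RP.N x) ∧
    (∀ (j : ℕ) x y, sN[j]? = some x → s[j]? = some y → y = RP.lab x)

/-- `f` is the control strategy generated by `RP`: on a sequence matched by a
plan-state path it returns the action of the last plan state, otherwise the
action of plan state 1. -/
def IsGenStrategy (RP : ReactivePlan Q A) (f : List Q → A) : Prop :=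
  ∀ s : List Q,
    (∀ sN x, RP.PlanMatch s sN → sN.getLast? = some x → f s = RP.act x) ∧
    ((¬ ∃ sN, RP.PlanMatch s sN) → f s = RP.act RP.one)

end ReactivePlan

/-- Büchi automaton with states `S` and input alphabet `L`. -/
structure Buchi (S L : Type*) where
  init : Set S
  trans : S → L → S → Prop
  acc : Set S

namespace Buchi

variable {S L : Type*}

/-- `σ` is a run accepted by `𝒜`. -/
def AccRun (𝒜 : Buchi S L) (σ : ℕ → S) : Prop :=
  σ 0 ∈ 𝒜.init ∧ (∀ i, ∃ l, 𝒜.trans (σ i) l (σ (i + 1))) ∧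
    ∃ x ∈ 𝒜.acc, ∀ n, ∃ m, n ≤ m ∧ σ m = x

/-- The infinite word `w` is accepted by `𝒜`. -/
def AccWord (𝒜 : Buchi S L) (w : ℕ → L) : Prop :=
  ∃ σ : ℕ → S, 𝒜.AccRun σ ∧ ∀ i, 𝒜.trans (σ i) (w i) (σ (i + 1))

/-- `𝒜` is total. -/
def Total (𝒜 : Buchi S L) : Prop :=
  (∃ x₀, 𝒜.init = {x₀}) ∧ ∀ x l, ∃! x', 𝒜.trans x l x'

end Buchi

/-- Transition relation of the product automaton `𝒜^φ_{T,q₀}` on `Q × S`. -/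
def ProdTrans {Q A B O S P : Type*} (T : ATS Q A B O) (𝒜 : Buchi S (Set P))
    (Pi : Q → Set P) : (Q × S) → A → B → (Q × S) → Prop :=
  fun p a b p' => T.trans p.1 a b p'.1 ∧ 𝒜.trans p.2 (Pi p.1) p'.2

/-- The product automaton viewed as an alternating transition system
(so that `Out`-sets for it are the ones of this system). -/
def ProdATS {Q A B O S P : Type*} (T : ATS Q A B O) (𝒜 : Buchi S (Set P))
    (Pi : Q → Set P) : ATS (Q × S) A B (Q × S) :=
  { trans := ProdTrans T 𝒜 Pi, obs := id }

/-- The accepting set `F_T = Q × F` of the product automaton. -/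
def ProdAcc (Q : Type*) {S P : Type*} (𝒜 : Buchi S (Set P)) : Set (Q × S) :=
  {p | p.2 ∈ 𝒜.acc}

/-- `σT` is a run accepted by the product automaton `𝒜^φ_{T,q₀}`. -/
def ProdAccRun {Q A B O S P : Type*} (T : ATS Q A B O) (𝒜 : Buchi S (Set P))
    (Pi : Q → Set P) (q₀ : Q) (x₀ : S) (σT : ℕ → Q × S) : Prop :=
  σT 0 = (q₀, x₀) ∧ (∀ i, ∃ a b, ProdTrans T 𝒜 Pi (σT i) a b (σT (i + 1))) ∧
    ∃ p ∈ ProdAcc Q 𝒜, ∀ n, ∃ m, n ≤ m ∧ σT m = p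

/-- The induced control strategy `f_T = f₀ ∘ Υ_T` of the product automaton. -/
def prodStrategy {Q A S : Type*} (f₀ : List Q → A) : List (Q × S) → A :=
  fun s => f₀ (s.map Prod.fst)

/-- `ReN` for finite sequences: the least index carrying a repeated occurrence
of an accepting state (`⊤` if there is none). -/
noncomputable def ReNList {X : Type*} (FT : Set X) (s : List X) : ℕ∞ :=
  sInf {e : ℕ∞ | ∃ n : ℕ, e = (n : ℕ∞) ∧
    ∃ i < n, ∃ y, s[i]? = some y ∧ s[n]? = some y ∧ y ∈ FT}

/-- `ReN` for infinite sequences. -/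
noncomputable def ReNFun {X : Type*} (FT : Set X) (σ : ℕ → X) : ℕ∞ :=
  sInf {e : ℕ∞ | ∃ n : ℕ, e = (n : ℕ∞) ∧ ∃ i < n, σ i = σ n ∧ σ n ∈ FT}

/-- The state set `S_f` of the accepting transition system `T_fin`: finite
outcomes of `f_T` from `(q₀,x₀)` in which every accepting state occurs at most
once. -/
def TfinStates {Q A B O S P : Type*} (T : ATS Q A B O) (𝒜 : Buchi S (Set P))
    (Pi : Q → Set P) (f₀ : List Q → A) (q₀ : Q) (x₀ : S) :
    Set (List (Q × S)) :=
  {s | FinOutcome (ProdATS T 𝒜 Pi) (prodStrategy f₀) (q₀, x₀) s ∧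
    ReNList (ProdAcc Q 𝒜) s = ⊤}

/-- The transition relation `→_f` of the accepting transition system `T_fin`
(with `step` the transition relation of the product automaton). -/
def TfinStep {X A' B' : Type*} (FT : Set X) (step : X → A' → B' → X → Prop)
    (fT : List X → A') (s : List X) (a : A') (s' : List X) : Prop :=
  a = fT s ∧ ∃ (p : X) (b : B') (lst : X), s.getLast? = some lst ∧
    step lst a b p ∧
    (s' = s ++ [p] ∨
      (ReNList FT (s ++ [p]) ≠ ⊤ ∧ s' ≠ s ++ [p] ∧ s' <+: (s ++ [p]) ∧
        s'.getLast? = some p))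

/-- `σT` is a trajectory of the accepting transition system `T_fin`. -/
def TfinTraj {X A' B' : Type*} (Sf : Set (List X)) (FT : Set X)
    (step : X → A' → B' → X → Prop) (fT : List X → A') (init : X)
    (σT : ℕ → X) : Prop :=
  ∃ seq : ℕ → List X, seq 0 = [init] ∧
    ∀ i, seq i ∈ Sf ∧ (seq i).getLast? = some (σT i) ∧
      ∃ a, TfinStep FT step fT (seq i) a (seq (i + 1))

theorem prefixSeq_getElem?_eq_some {X : Type*} {σ : ℕ → X} {n j : ℕ} {x : X} :
    (prefixSeq σ n)[j]? = some x ↔ j < n ∧ σ j = x := by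
  simp only [prefixSeq, List.getElem?_map, Option.map_eq_some_iff,
    List.getElem?_eq_some_iff, List.length_range, List.getElem_range]
  grind

theorem prefixSeq_getLast?_succ {X : Type*} (σ : ℕ → X) (n : ℕ) :
    (prefixSeq σ (n + 1)).getLast? = some (σ n) := by
  simp [prefixSeq, List.range_succ]

namespace ReactivePlan

variable {Q A : Type*} {RP : ReactivePlan Q A}

theorem planMatch_prefixSeq {σ : ℕ → Q} {σN : ℕ → Fin RP.k} {n : ℕ}
    (h0 : σN 0 = RP.one) (hstep : ∀ j < n, σN (j + 1) ∈ RP.N (σN j))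
    (hlab : ∀ j ≤ n, RP.lab (σN j) = σ j) :
    RP.PlanMatch (prefixSeq σ (n + 1)) (prefixSeq σN (n + 1)) := by
  refine ⟨by simp [prefixSeq], ?_, fun j x y hx hy => ?_, fun j x y hx hy => ?_⟩
  · rw [List.head?_eq_getElem?, prefixSeq_getElem?_eq_some]
    exact ⟨n.succ_pos, h0⟩
  · obtain ⟨-, rfl⟩ := prefixSeq_getElem?_eq_some.1 hx
    obtain ⟨hj, rfl⟩ := prefixSeq_getElem?_eq_some.1 hy
    exact hstep j (Nat.lt_of_succ_lt_succ hj)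
  · obtain ⟨hj, rfl⟩ := prefixSeq_getElem?_eq_some.1 hx
    obtain ⟨-, rfl⟩ := prefixSeq_getElem?_eq_some.1 hy
    exact (hlab j (Nat.le_of_lt_succ hj)).symm

theorem IsGenStrategy.apply_prefixSeq {f : List Q → A} (hf : RP.IsGenStrategy f)
    {σ : ℕ → Q} {σN : ℕ → Fin RP.k} {n : ℕ}
    (h0 : σN 0 = RP.one) (hstep : ∀ j < n, σN (j + 1) ∈ RP.N (σN j))
    (hlab : ∀ j ≤ n, RP.lab (σN j) = σ j) :
    f (prefixSeq σ (n + 1)) = RP.act (σN n) :=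
  (hf _).1 _ _ (planMatch_prefixSeq h0 hstep hlab) (prefixSeq_getLast?_succ σN n)

theorem OfATS.exists_mem_N_iff {B O : Type*} {T : ATS Q A B O} (hRP : RP.OfATS T)
    {i : Fin RP.k} {q : Q} :
    (∃ j ∈ RP.N i, RP.lab j = q) ↔ ∃ b, T.trans (RP.lab i) (RP.act i) b q :=
  Set.ext_iff.1 (hRP i) q

open Classical in
/-- Follow the world-state sequence `σ` through the plan, falling back to plan
state 1 when no successor carries the required label. -/
noncomputable def follow (RP : ReactivePlan Q A) (σ : ℕ → Q) : ℕ → Fin RP.k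
  | 0 => RP.one
  | n + 1 =>
      if h : ∃ j ∈ RP.N (RP.follow σ n), RP.lab j = σ (n + 1) then h.choose else RP.one

theorem follow_succ_spec {σ : ℕ → Q} {n : ℕ}
    (h : ∃ j ∈ RP.N (RP.follow σ n), RP.lab j = σ (n + 1)) :
    RP.follow σ (n + 1) ∈ RP.N (RP.follow σ n) ∧
      RP.lab (RP.follow σ (n + 1)) = σ (n + 1) := by
  rw [follow, dif_pos h]
  exact h.choose_spec

theorem follow_spec_of_infOutcome {B O : Type*} {T : ATS Q A B O} (hRP : RP.OfATS T)
    {f : List Q → A} (hf : RP.IsGenStrategy f) {σ : ℕ → Q}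
    (hσ : InfOutcome T f (RP.lab RP.one) σ) (n : ℕ) :
    (∀ j < n, RP.follow σ (j + 1) ∈ RP.N (RP.follow σ j)) ∧
      ∀ j ≤ n, RP.lab (RP.follow σ j) = σ j := by
  induction n with
  | zero =>
    refine ⟨by simp, fun j hj => ?_⟩
    obtain rfl := Nat.le_zero.1 hj
    exact hσ.1.symm
  | succ n ih =>
    obtain ⟨b, hb⟩ := hσ.2 n
    rw [hf.apply_prefixSeq rfl ih.1 ih.2, ← ih.2 n le_rfl] at hb
    obtain ⟨hmem, hlab⟩ := follow_succ_spec (hRP.exists_mem_N_iff.2 ⟨b, hb⟩)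
    exact ⟨Nat.forall_lt_succ_right.2 ⟨ih.1, hmem⟩, fun j hj =>
      (Nat.le_succ_iff.1 hj).elim (ih.2 j) fun h => h ▸ hlab⟩

end ReactivePlan

/-- Theorem 4.9(1): `Out_T(q₁, f_RP)` consists exactly of
the trajectories generated by `RP`. -/
theorem stmt3 {Q A B O : Type*} [Finite Q] [Finite A] [Finite B]
    (T : ATS Q A B O) (hnb : T.NonBlocking)
    (RP : ReactivePlan Q A) (hRP : RP.OfATS T)
    (huniq : ∀ (i : Fin RP.k) (q : Q), ∀ j1 ∈ RP.N i, ∀ j2 ∈ RP.N i,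
      RP.lab j1 = q → RP.lab j2 = q → j1 = j2)
    (fRP : List Q → A) (hf : RP.IsGenStrategy fRP) :
    ∀ σ : ℕ → Q, InfOutcome T fRP (RP.lab RP.one) σ ↔ RP.Traj σ := by
  refine fun σ => ⟨fun hσ => ⟨RP.follow σ, rfl, fun j => ?_⟩, ?_⟩
  · have h := ReactivePlan.follow_spec_of_infOutcome hRP hf hσ (j + 1)
    exact ⟨h.1 j j.lt_succ_self, h.2 j j.le_succ⟩
  · rintro ⟨σN, h0, h⟩
    refine ⟨by rw [← (h 0).2, h0], fun i => ?_⟩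
    rw [hf.apply_prefixSeq h0 (fun j _ => (h j).1) (fun j _ => (h j).2), ← (h i).2]
    exact hRP.exists_mem_N_iff.1 ⟨_, (h i).1, (h (i + 1)).2⟩
end

section
/- Let T=(Q,A,B,→,O,H) be a finite non-blocking alternating transition system, φ an LTL₋X(P) formula, ∏:Q→2^P a valuation function, and let RP={(1,q₁,a₁,N₁),…,(k,q_k,a_k,N_k)} be a reactive plan of T such that for every plan state i and every q∈Q there exists at most one plan state j∈N_i with q_j=q. Let f_RP be the control strategy generated by RP. If RP satisfies φ w.r.t. ∏, then every σ∈Out_T(q₁,f_RP) satisfies φ w.r.t. ∏. -/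
/-- A sequence of successive plan states starting in plan state 1 and labeled by
the first `n + 1` entries of `σ` determines the value of the generated strategy
on that prefix. -/
theorem ReactivePlan.IsGenStrategy.apply_prefixSeq_s4 {Q A : Type*}
    {RP : ReactivePlan Q A} {f : List Q → A} (hf : RP.IsGenStrategy f)
    {σ : ℕ → Q} {σN : ℕ → Fin RP.k} {n : ℕ} (h0 : σN 0 = RP.one)
    (hN : ∀ j < n, σN (j + 1) ∈ RP.N (σN j))
    (hlab : ∀ j ≤ n, RP.lab (σN j) = σ j) :
    f (prefixSeq σ (n + 1)) = RP.act (σN n) := by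
  refine (hf _).1 (prefixSeq σN (n + 1)) (σN n) ⟨?_, ?_, ?_, ?_⟩ ?_
  · simp [prefixSeq]
  · simp [prefixSeq, List.range_succ_eq_map, h0]
  · intro j x y hx hy
    simp only [prefixSeq, List.getElem?_map, Option.map_eq_some_iff,
      List.getElem?_eq_some_iff, List.getElem_range, List.length_range] at hx hy
    obtain ⟨_, ⟨_, rfl⟩, rfl⟩ := hx
    obtain ⟨_, ⟨hj, rfl⟩, rfl⟩ := hy
    exact hN j (by omega)
  · intro j x y hx hy
    simp only [prefixSeq, List.getElem?_map, Option.map_eq_some_iff,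
      List.getElem?_eq_some_iff, List.getElem_range, List.length_range] at hx hy
    obtain ⟨_, ⟨_, rfl⟩, rfl⟩ := hx
    obtain ⟨_, ⟨hj, rfl⟩, rfl⟩ := hy
    exact (hlab j (by omega)).symm
  · simp [prefixSeq, List.range_succ]

/-- Every outcome of the generated strategy from the label of plan state 1 is a
trajectory generated by the reactive plan. -/
theorem ReactivePlan.IsGenStrategy.traj_of_infOutcome {Q A B O : Type*}
    {T : ATS Q A B O} {RP : ReactivePlan Q A} (hRP : RP.OfATS T)
    {f : List Q → A} (hf : RP.IsGenStrategy f) {σ : ℕ → Q}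
    (hσ : InfOutcome T f (RP.lab RP.one) σ) : RP.Traj σ := by
  have hnext : ∀ (i : Fin RP.k) (q : Q), ∃ j,
      (∃ b, T.trans (RP.lab i) (RP.act i) b q) → j ∈ RP.N i ∧ RP.lab j = q := by
    intro i q
    by_cases h : ∃ b, T.trans (RP.lab i) (RP.act i) b q
    · obtain ⟨j, hj⟩ := (Set.ext_iff.mp (hRP i) q).mpr h
      exact ⟨j, fun _ => hj⟩
    · exact ⟨i, fun h' => absurd h' h⟩
  choose next hnext using hnext
  let σN : ℕ → Fin RP.k := fun n => Nat.rec RP.one (fun m i => next i (σ (m + 1))) n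
  have key : ∀ n, (∀ j < n, σN (j + 1) ∈ RP.N (σN j)) ∧
      ∀ j ≤ n, RP.lab (σN j) = σ j := by
    intro n
    induction n with
    | zero =>
      refine ⟨fun j hj => absurd hj (Nat.not_lt_zero j), fun j hj => ?_⟩
      obtain rfl := Nat.le_zero.mp hj
      exact hσ.1.symm
    | succ n ih =>
      obtain ⟨b, hb⟩ := hσ.2 n
      rw [hf.apply_prefixSeq_s4 rfl ih.1 ih.2, ← ih.2 n le_rfl] at hb
      obtain ⟨hmem, hlab⟩ := hnext (σN n) (σ (n + 1)) ⟨b, hb⟩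
      refine ⟨fun j hj => ?_, fun j hj => ?_⟩
      · rcases Nat.lt_succ_iff_lt_or_eq.mp hj with h | rfl
        · exact ih.1 j h
        · exact hmem
      · rcases Nat.le_succ_iff.mp hj with h | rfl
        · exact ih.2 j h
        · exact hlab
  exact ⟨σN, rfl, fun j => ⟨(key (j + 1)).1 j j.lt_succ_self, (key j).2 j le_rfl⟩⟩

/-- Theorem 4.9(2): if `RP` satisfies `φ` then every
outcome of the generated control strategy `f_RP` from `q₁` satisfies `φ`. -/
theorem stmt4 {Q A B O P : Type*} [Finite Q] [Finite A] [Finite B] [Finite P]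
    (T : ATS Q A B O) (hnb : T.NonBlocking)
    (φ : LTL P) (Pi : Q → Set P)
    (RP : ReactivePlan Q A) (hRP : RP.OfATS T)
    (huniq : ∀ (i : Fin RP.k) (q : Q), ∀ j1 ∈ RP.N i, ∀ j2 ∈ RP.N i,
      RP.lab j1 = q → RP.lab j2 = q → j1 = j2)
    (fRP : List Q → A) (hf : RP.IsGenStrategy fRP)
    (hsat : RP.SatPlan φ Pi) :
    ∀ σ : ℕ → Q, InfOutcome T fRP (RP.lab RP.one) σ → SatTraj Pi σ φ := by
  exact fun σ hσ => hsat.2 σ (hf.traj_of_infOutcome hRP hσ)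
end

section
/- Let T=(Q,A,B,→,O,H) be a finite non-blocking alternating transition system, q₀∈Q, ∏:Q→2^P a valuation function, φ an LTL₋X(P) formula, 𝒜_φ=(S,{x₀},2^P,→_{𝒜_φ},F) a total Büchi automaton accepting exactly the infinite words over 2^P satisfying φ, and f₀ a control strategy of T such that every σ∈Out_T(q₀,f₀) satisfies φ w.r.t. ∏. Let f_T := f₀∘Υ_T. Then every σ_T ∈ Out((q₀,x₀),f_T) is a run accepted by the product automaton 𝒜^φ_{T,q₀}. -/
theorem mem_frequently_of_finite {X : Type*} [Finite X] (u : ℕ → X) (V : Set X)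
    (h : ∀ n, ∃ m, n ≤ m ∧ u m ∈ V) : ∃ p ∈ V, ∀ n, ∃ m, n ≤ m ∧ u m = p := by
  by_contra! hc
  have hfin : ∀ p ∈ V, ∀ᶠ m in Filter.atTop, u m ≠ p := fun p hp => by
    obtain ⟨n, hn⟩ := hc p hp
    exact Filter.eventually_atTop.2 ⟨n, hn⟩
  have hall : ∀ᶠ m in Filter.atTop, ∀ p, p ∈ V → u m ≠ p :=
    Filter.eventually_all.2 fun p => by
      by_cases hp : p ∈ V
      · exact (hfin p hp).mono fun m hm _ => hm
      · exact Filter.Eventually.of_forall fun m hm => absurd hm hp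
  obtain ⟨N, hN⟩ := Filter.eventually_atTop.1 hall
  obtain ⟨m, hm, hV⟩ := h N
  exact hN m hm (u m) hV rfl

theorem Buchi.Total.run_unique {S L : Type*} {𝒜 : Buchi S L} (htot : 𝒜.Total)
    {w : ℕ → L} {σ τ : ℕ → S} (h0 : σ 0 = τ 0)
    (hσ : ∀ i, 𝒜.trans (σ i) (w i) (σ (i + 1)))
    (hτ : ∀ i, 𝒜.trans (τ i) (w i) (τ (i + 1))) (i : ℕ) : σ i = τ i := by
  induction i with
  | zero => exact h0
  | succ i ih => exact (htot.2 (σ i) (w i)).unique (hσ i) (ih ▸ hτ i)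

theorem InfOutcome.fst_of_prod {Q A B O S P : Type*} {T : ATS Q A B O}
    {𝒜 : Buchi S (Set P)} {Pi : Q → Set P} {f₀ : List Q → A} {q₀ : Q} {x₀ : S}
    {σT : ℕ → Q × S}
    (h : InfOutcome (ProdATS T 𝒜 Pi) (prodStrategy f₀) (q₀, x₀) σT) :
    InfOutcome T f₀ q₀ (fun i => (σT i).1) := by
  refine ⟨congrArg Prod.fst h.1, fun i => ?_⟩
  obtain ⟨b, hb, -⟩ := h.2 i
  refine ⟨b, ?_⟩
  simpa [prodStrategy, prefixSeq, Function.comp_def] using hb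

/-- Lemma 5.7(2): every infinite outcome of `f_T = f₀ ∘ Υ_T`
from `(q₀,x₀)` is a run accepted by the product automaton `𝒜^φ_{T,q₀}`. -/
theorem stmt8 {Q A B O S P : Type*} [Finite Q] [Finite A] [Finite B]
    [Finite S] [Finite P]
    (T : ATS Q A B O) (hnb : T.NonBlocking) (q₀ : Q)
    (Pi : Q → Set P) (φ : LTL P)
    (𝒜 : Buchi S (Set P)) (x₀ : S) (hinit : 𝒜.init = {x₀})
    (htot : 𝒜.Total)
    (hacc : ∀ w : ℕ → Set P, 𝒜.AccWord w ↔ LTL.Sat w φ)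
    (f₀ : List Q → A)
    (hsat : ∀ σ : ℕ → Q, InfOutcome T f₀ q₀ σ → SatTraj Pi σ φ) :
    ∀ σT : ℕ → Q × S,
      InfOutcome (ProdATS T 𝒜 Pi) (prodStrategy f₀) (q₀, x₀) σT →
      ProdAccRun T 𝒜 Pi q₀ x₀ σT := by
  intro σT h
  have htrans : ∀ i, 𝒜.trans (σT i).2 (Pi (σT i).1) (σT (i + 1)).2 := fun i => by
    obtain ⟨b, -, hb⟩ := h.2 i
    exact hb
  obtain ⟨τ, ⟨hτ0, -, x, hx, hinf⟩, hτ⟩ :=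
    (hacc fun i => Pi (σT i).1).2 (hsat _ h.fst_of_prod)
  have h0 : (σT 0).2 = τ 0 := by
    rw [hinit, Set.mem_singleton_iff] at hτ0
    rw [hτ0, h.1]
  have heq := htot.run_unique h0 htrans hτ
  refine ⟨h.1, fun i => ?_, mem_frequently_of_finite σT (ProdAcc Q 𝒜) fun n => ?_⟩
  · obtain ⟨b, hb⟩ := h.2 i
    exact ⟨_, b, hb⟩
  · obtain ⟨m, hm, hmx⟩ := hinf n
    refine ⟨m, hm, ?_⟩
    change (σT m).2 ∈ 𝒜.acc
    rw [heq m, hmx]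
    exact hx
end

section
/- Let T=(Q,A,B,→,O,H) be a finite non-blocking alternating transition system, q₀∈Q, ∏:Q→2^P a valuation function, φ an LTL₋X(P) formula, 𝒜_φ=(S,{x₀},2^P,→_{𝒜_φ},F) a total Büchi automaton accepting exactly the infinite words over 2^P satisfying φ, and f₀ a control strategy of T such that every σ∈Out_T(q₀,f₀) satisfies φ w.r.t. ∏. Let f_T := f₀∘Υ_T and let T_fin(𝒜^φ_{T,q₀},f_T)=(S_f,A,→_f,lab) be the accepting transition system w.r.t. 𝒜^φ_{T,q₀} and f_T. Then every trajectory σ_T of T_fin(𝒜^φ_{T,q₀},f_T) is a run accepted by 𝒜^φ_{T,q₀}. -/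
theorem exists_mem_infinitely_often {X : Type*} [Finite X] {F : Set X} {σ : ℕ → X}
    (h : ∀ n, ∃ m, n ≤ m ∧ σ m ∈ F) : ∃ p ∈ F, ∀ n, ∃ m, n ≤ m ∧ σ m = p := by
  by_contra! hc
  have hev : ∀ p : X, ∀ᶠ m in Filter.atTop, p ∈ F → σ m ≠ p := by
    intro p
    by_cases hp : p ∈ F
    · obtain ⟨n, hn⟩ := hc p hp
      exact Filter.eventually_atTop.2 ⟨n, fun m hm _ => hn m hm⟩
    · exact Filter.Eventually.of_forall fun m hp' => absurd hp' hp
  obtain ⟨n, hn⟩ := Filter.eventually_atTop.1 (Filter.eventually_all.2 hev)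
  obtain ⟨m, hm, hF⟩ := h n
  exact hn m hm _ hF rfl

theorem reNList_eq_top_iff {X : Type*} {FT : Set X} {s : List X} :
    ReNList FT s = ⊤ ↔
      ∀ (i n : ℕ) (y : X), i < n → s[i]? = some y → s[n]? = some y → y ∉ FT := by
  unfold ReNList
  rw [sInf_eq_top]
  constructor
  · intro h i n y hin hi hn hy
    exact ENat.natCast_ne_top n (h n ⟨n, rfl, i, hin, y, hi, hn, hy⟩)
  · rintro h _ ⟨n, rfl, i, hin, y, hi, hn, hy⟩
    exact absurd hy (h i n y hin hi hn)

/-- If appending `p` creates the first repetition of a state of `FT`, then `p ∈ FT`. -/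
theorem mem_of_reNList_append_ne_top {X : Type*} {FT : Set X} {s : List X} {p : X}
    (hs : ReNList FT s = ⊤) (hsp : ReNList FT (s ++ [p]) ≠ ⊤) : p ∈ FT := by
  rw [reNList_eq_top_iff] at hs
  rw [Ne, reNList_eq_top_iff] at hsp
  by_contra hp
  refine hsp fun i n y hin hi hn hy => ?_
  by_cases hns : n < s.length
  · rw [List.getElem?_append_left (hin.trans hns)] at hi
    rw [List.getElem?_append_left hns] at hn
    exact hs i n y hin hi hn hy
  · rw [List.getElem?_append_right (not_lt.1 hns)] at hn
    have hyp : y = p := by simpa using List.mem_of_getElem? hn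
    exact hp (hyp ▸ hy)

/-- An increasing chain of finite outcomes has an infinite outcome as its limit. -/
theorem exists_infOutcome_of_chain {Q A B O : Type*} {T : ATS Q A B O} {f : List Q → A}
    {q : Q} {s : ℕ → List Q} (hs : ∀ k, FinOutcome T f q (s k))
    (hstep : ∀ k, ∃ p, s (k + 1) = s k ++ [p]) :
    ∃ σ : ℕ → Q, InfOutcome T f q σ ∧ ∀ n k, n ≤ k → (s k)[n]? = some (σ n) := by
  have hlen : ∀ k, k < (s k).length := by
    intro k
    induction k with
    | zero => exact List.length_pos_of_ne_nil (hs 0).1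
    | succ k ih =>
      obtain ⟨p, hp⟩ := hstep k
      simpa [hp] using ih
  have hlim : ∀ n k, n ≤ k → (s k)[n]? = some ((s n)[n]'(hlen n)) := by
    intro n k hnk
    induction k, hnk using Nat.le_induction with
    | base => exact List.getElem?_eq_getElem (hlen n)
    | succ k hnk ih =>
      obtain ⟨p, hp⟩ := hstep k
      rw [hp, List.getElem?_append_left (hnk.trans_lt (hlen k)), ih]
  refine ⟨fun n => (s n)[n]'(hlen n), ⟨?_, fun i => ?_⟩, hlim⟩
  · have h := (hs 0).2.1
    rw [List.head?_eq_getElem?, hlim 0 0 le_rfl] at h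
    exact Option.some.inj h
  · have h := (hs (i + 1)).2.2 i _ _ (hlim i (i + 1) i.le_succ) (hlim (i + 1) (i + 1) le_rfl)
    have htake : (s (i + 1)).take (i + 1) =
        prefixSeq (fun n => (s n)[n]'(hlen n)) (i + 1) := by
      refine List.ext_getElem? fun m => ?_
      by_cases hm : m < i + 1
      · simp [prefixSeq, hm, hlim m (i + 1) hm.le]
      · simp [prefixSeq, hm]
    rwa [htake] at h

/-- If `f₀` enforces the property accepted by `𝒜`, every infinite outcome of the product
automaton visits some accepting state infinitely often. -/
theorem exists_prodAcc_infinitely_often {Q A B O S P : Type*} [Finite Q] [Finite S]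
    {T : ATS Q A B O} {q₀ : Q} {Pi : Q → Set P} {𝒜 : Buchi S (Set P)} {x₀ : S}
    (hinit : 𝒜.init = {x₀}) (htot : 𝒜.Total) {f₀ : List Q → A}
    (hacc : ∀ σ : ℕ → Q, InfOutcome T f₀ q₀ σ → 𝒜.AccWord fun i => Pi (σ i))
    {σ : ℕ → Q × S} (hσ : InfOutcome (ProdATS T 𝒜 Pi) (prodStrategy f₀) (q₀, x₀) σ) :
    ∃ p ∈ ProdAcc Q 𝒜, ∀ n, ∃ m, n ≤ m ∧ σ m = p := by
  have hproj : InfOutcome T f₀ q₀ fun i => (σ i).1 := by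
    refine ⟨congrArg Prod.fst hσ.1, fun i => ?_⟩
    obtain ⟨b, hb, -⟩ := hσ.2 i
    refine ⟨b, ?_⟩
    simpa [prodStrategy, prefixSeq, Function.comp_def] using hb
  obtain ⟨ρ, ⟨hρ0, -, x, hxF, hx⟩, hρ⟩ := hacc _ hproj
  have heq : ∀ i, ρ i = (σ i).2 := by
    intro i
    induction i with
    | zero =>
      rw [hinit] at hρ0
      rw [hσ.1]
      exact hρ0
    | succ i ih =>
      obtain ⟨b, -, hb⟩ := hσ.2 i
      have h := hρ i
      rw [ih] at h
      exact (htot.2 _ _).unique h hb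
  refine exists_mem_infinitely_often fun n => ?_
  obtain ⟨m, hnm, hm⟩ := hx n
  refine ⟨m, hnm, ?_⟩
  change (σ m).2 ∈ 𝒜.acc
  rw [← heq, hm]
  exact hxF

/-- Lemma 5.11(2): every trajectory of the accepting
transition system `T_fin` is a run accepted by the product automaton. -/
theorem stmt14 {Q A B O S P : Type*} [Finite Q] [Finite A] [Finite B]
    [Finite S] [Finite P]
    (T : ATS Q A B O) (hnb : T.NonBlocking) (q₀ : Q)
    (Pi : Q → Set P) (φ : LTL P)
    (𝒜 : Buchi S (Set P)) (x₀ : S) (hinit : 𝒜.init = {x₀})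
    (htot : 𝒜.Total)
    (hacc : ∀ w : ℕ → Set P, 𝒜.AccWord w ↔ LTL.Sat w φ)
    (f₀ : List Q → A)
    (hsat : ∀ σ : ℕ → Q, InfOutcome T f₀ q₀ σ → SatTraj Pi σ φ) :
    ∀ σT : ℕ → Q × S,
      TfinTraj (TfinStates T 𝒜 Pi f₀ q₀ x₀) (ProdAcc Q 𝒜)
        (ProdTrans T 𝒜 Pi) (prodStrategy f₀) (q₀, x₀) σT →
      ProdAccRun T 𝒜 Pi q₀ x₀ σT := by
  rintro σT ⟨seq, h0, hseq⟩
  have hlast : ∀ i, (seq i).getLast? = some (σT i) := fun i => (hseq i).2.1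
  have hσ : ∀ i, (∃ a b, ProdTrans T 𝒜 Pi (σT i) a b (σT (i + 1))) ∧
      ((∃ p, seq (i + 1) = seq i ++ [p]) ∨ σT (i + 1) ∈ ProdAcc Q 𝒜) := by
    intro i
    obtain ⟨a, -, p, b, lst, hl, hstep, hor⟩ := (hseq i).2.2
    have hp : σT (i + 1) = p := by
      have h := hlast (i + 1)
      rcases hor with h' | ⟨-, -, -, h'⟩
      · simpa [h', eq_comm] using h
      · exact Option.some.inj (h.symm.trans h')
    have hli : σT i = lst := Option.some.inj ((hlast i).symm.trans hl)
    refine ⟨⟨a, b, hli ▸ hp ▸ hstep⟩, ?_⟩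
    rcases hor with h' | ⟨hne, -, -, -⟩
    · exact Or.inl ⟨p, h'⟩
    · exact Or.inr (hp ▸ mem_of_reNList_append_ne_top (hseq i).1.2 hne)
  refine ⟨?_, fun i => (hσ i).1, exists_mem_infinitely_often fun n => ?_⟩
  · simpa [h0, eq_comm] using hlast 0
  by_contra! hn
  have hchain : ∀ k, ∃ p, seq (n + (k + 1)) = seq (n + k) ++ [p] := fun k =>
    (hσ (n + k)).2.resolve_right (hn _ (by omega))
  obtain ⟨σ, hout, hpre⟩ :=
    exists_infOutcome_of_chain (s := fun k => seq (n + k)) (fun k => (hseq (n + k)).1.1) hchain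
  obtain ⟨p, hpF, hp⟩ := exists_prodAcc_infinitely_often hinit htot
    (fun τ hτ => (hacc _).2 (hsat τ hτ)) hout
  obtain ⟨i, -, hi⟩ := hp 0
  obtain ⟨j, hij, hj⟩ := hp (i + 1)
  exact reNList_eq_top_iff.1 (hseq (n + j)).1.2 i j p hij
    (hi ▸ hpre i j (by omega)) (hj ▸ hpre j j le_rfl) hpF
end

section
/- Let T=(Q,A,B,→,O,H) be a finite non-blocking alternating transition system, q₀∈Q, ∏:Q→2^P a valuation function, φ an LTL₋X(P) formula, 𝒜_φ=(S,{x₀},2^P,→_{𝒜_φ},F) a total Büchi automaton accepting exactly the infinite words over 2^P satisfying φ, and f₀ a control strategy of T such that every σ∈Out_T(q₀,f₀) satisfies φ w.r.t. ∏. Let f_T := f₀∘Υ_T and let T_fin(𝒜^φ_{T,q₀},f_T)=(S_f,A,→_f,lab) be the accepting transition system w.r.t. 𝒜^φ_{T,q₀} and f_T. Then for every s_T∈S_f and every q∈Q, if Υ_T(s_T[end]) →^{f_T(s_T),b} q in T for some b∈B, then there exists s_T'∈S_f such that s_T →^{f_T(s_T)}_f s_T' and the Q-component of s_T'[end] equals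 q. -/
theorem ReNList_eq_top_iff {X : Type*} {FT : Set X} {s : List X} :
    ReNList FT s = ⊤ ↔
      ∀ n : ℕ, ∀ i < n, ∀ y ∈ FT, s[i]? = some y → s[n]? ≠ some y := by
  simp only [ReNList, sInf_eq_top, Set.mem_ofPred_eq]
  constructor
  · intro h n i hi y hy h₁ h₂
    exact ENat.natCast_ne_top n (h n ⟨n, rfl, i, hi, y, h₁, h₂, hy⟩)
  · rintro h _ ⟨n, -, i, hi, y, h₁, h₂, hy⟩
    exact absurd h₂ (h n i hi y hy h₁)

theorem ReNList_eq_top_of_isPrefix {X : Type*} {FT : Set X} {s t : List X}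
    (hst : s <+: t) (ht : ReNList FT t = ⊤) : ReNList FT s = ⊤ := by
  rw [ReNList_eq_top_iff] at ht ⊢
  intro n i hi y hy h₁ h₂
  rw [List.prefix_iff_getElem?] at hst
  obtain ⟨hi', rfl⟩ := List.getElem?_eq_some_iff.mp h₁
  obtain ⟨hn', hn⟩ := List.getElem?_eq_some_iff.mp h₂
  exact ht n i hi _ hy (hst i hi') (hn ▸ hst n hn')

theorem FinOutcome.take {Q A B O : Type*} {T : ATS Q A B O} {f : List Q → A} {q : Q}
    {s : List Q} (hs : FinOutcome T f q s) (n : ℕ) :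
    FinOutcome T f q (s.take (n + 1)) := by
  obtain ⟨hne, hhead, hstep⟩ := hs
  refine ⟨by simpa using hne, by simpa [List.head?_take] using hhead, ?_⟩
  intro i x y hx hy
  rw [List.getElem?_take] at hx hy
  split_ifs at hx hy with h₁ h₂
  rw [List.take_take, min_eq_left (by omega)]
  exact hstep i x y hx hy

theorem FinOutcome.append_singleton {Q A B O : Type*} {T : ATS Q A B O} {f : List Q → A}
    {q : Q} {s : List Q} (hs : FinOutcome T f q s) {l p : Q} {b : B}
    (hl : s.getLast? = some l) (hp : T.trans l (f s) b p) :
    FinOutcome T f q (s ++ [p]) := by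
  obtain ⟨hne, hhead, hstep⟩ := hs
  refine ⟨by simp, by simp [hhead], ?_⟩
  intro i x y hx hy
  have hi : i + 1 < s.length + 1 := by
    simpa using (List.getElem?_eq_some_iff.mp hy).1
  rw [List.getElem?_append_left (by omega)] at hx
  rw [List.take_append_of_le_length (by omega)]
  rcases Nat.lt_or_ge (i + 1) s.length with h | h
  · rw [List.getElem?_append_left h] at hy
    exact hstep i x y hx hy
  · have hlen : i + 1 = s.length := by omega
    rw [List.getLast?_eq_getElem?, ← hlen, Nat.add_sub_cancel, hx] at hl
    rw [hlen, List.getElem?_concat_length] at hy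
    rw [hlen, List.take_length]
    cases hl
    cases hy
    exact ⟨b, hp⟩

/-- A sequence that first repeats an accepting state at its last entry `p` has already
visited `p` before. -/
theorem exists_getElem?_eq_of_ReNList_append_ne_top {X : Type*} {FT : Set X} {s : List X}
    {p : X} (hs : ReNList FT s = ⊤) (hp : ReNList FT (s ++ [p]) ≠ ⊤) :
    ∃ i < s.length, s[i]? = some p := by
  rw [Ne, ReNList_eq_top_iff] at hp
  rw [ReNList_eq_top_iff] at hs
  push Not at hp
  obtain ⟨n, i, hi, y, hy, h₁, h₂⟩ := hp
  have hn : n < s.length + 1 := by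
    simpa using (List.getElem?_eq_some_iff.mp h₂).1
  rw [List.getElem?_append_left (by omega)] at h₁
  rcases Nat.lt_or_ge n s.length with h | h
  · rw [List.getElem?_append_left h] at h₂
    exact absurd h₂ (hs n i hi y hy h₁)
  · obtain rfl : n = s.length := by omega
    rw [List.getElem?_concat_length] at h₂
    cases h₂
    exact ⟨i, hi, h₁⟩

/-- Lemma 5.11(3): for every state `s_T ∈ S_f` of `T_fin`
and every transition `Υ_T(s_T[end]) →^{f_T(s_T),b} q` of `T`, there is an
`→_f`-successor `s_T'` of `s_T` in `S_f` whose last state has `Q`-component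
`q`. -/
theorem stmt15 {Q A B O S P : Type*} [Finite Q] [Finite A] [Finite B]
    [Finite S] [Finite P]
    (T : ATS Q A B O) (hnb : T.NonBlocking) (q₀ : Q)
    (Pi : Q → Set P) (φ : LTL P)
    (𝒜 : Buchi S (Set P)) (x₀ : S) (hinit : 𝒜.init = {x₀})
    (htot : 𝒜.Total)
    (hacc : ∀ w : ℕ → Set P, 𝒜.AccWord w ↔ LTL.Sat w φ)
    (f₀ : List Q → A)
    (hsat : ∀ σ : ℕ → Q, InfOutcome T f₀ q₀ σ → SatTraj Pi σ φ) :
    ∀ sT ∈ TfinStates T 𝒜 Pi f₀ q₀ x₀, ∀ (q : Q) (b : B) (lst : Q × S),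
      sT.getLast? = some lst → T.trans lst.1 (prodStrategy f₀ sT) b q →
      ∃ sT' ∈ TfinStates T 𝒜 Pi f₀ q₀ x₀,
        TfinStep (ProdAcc Q 𝒜) (ProdTrans T 𝒜 Pi) (prodStrategy f₀)
          sT (prodStrategy f₀ sT) sT' ∧
        ∃ p : Q × S, sT'.getLast? = some p ∧ p.1 = q := by
  intro s ⟨hout, hren⟩ q b lst hlst htrans
  obtain ⟨x, hx, -⟩ := htot.2 lst.2 (Pi lst.1)
  have hstep : ProdTrans T 𝒜 Pi lst (prodStrategy f₀ s) b (q, x) := ⟨htrans, hx⟩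
  by_cases htop : ReNList (ProdAcc Q 𝒜) (s ++ [(q, x)]) = ⊤
  · exact ⟨s ++ [(q, x)], ⟨hout.append_singleton hlst hstep, htop⟩,
      ⟨rfl, (q, x), b, lst, hlst, hstep, Or.inl rfl⟩, (q, x), by simp, rfl⟩
  · obtain ⟨i, hi, hget⟩ := exists_getElem?_eq_of_ReNList_append_ne_top hren htop
    have hlast : (s.take (i + 1)).getLast? = some (q, x) := by
      simp [List.getLast?_take, hget]
    have hne : s.take (i + 1) ≠ s ++ [(q, x)] := fun h => by
      have := congrArg List.length h
      simp only [List.length_take, List.length_append, List.length_singleton] at this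
      omega
    exact ⟨s.take (i + 1),
      ⟨hout.take i, ReNList_eq_top_of_isPrefix (List.take_prefix _ _) hren⟩,
      ⟨rfl, (q, x), b, lst, hlst, hstep, Or.inr ⟨htop, hne,
        (List.take_prefix _ _).trans (List.prefix_append _ _), hlast⟩⟩,
      (q, x), hlast, rfl⟩
end
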